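/- If (k = 4 and n ≥ 8) or (k ≥ 5 and n ≥ k+3), then C(k,2) ≤ C(n−2, k−2) − n, where C(a,b) denotes the binomial coefficient 'a choose b'. -/

import Mathlib

theorem choose_two_add_le_choose_three (i : ℕ) :
    Nat.choose (i + 5) 2 + (i + 8) ≤ Nat.choose (i + 6) 3 := by
  induction i with
  | zero => decide
  | succ i ih =>
    have h1 : (i + 1 + 6).choose 3 = (i + 6).choose 2 + (i + 6).choose 3 :=
      Nat.choose_succ_succ (i + 6) 2
    have h2 : (i + 1 + 5).choose 2 = (i + 5).choose 1 + (i + 5).choose 2 :=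
      Nat.choose_succ_succ (i + 5) 1
    have h3 : (i + 6).choose 2 = (i + 5).choose 1 + (i + 5).choose 2 :=
      Nat.choose_succ_succ (i + 5) 1
    have h4 : 0 < (i + 5).choose 2 := Nat.choose_pos (by omega)
    omega

theorem choose_add_le_choose_add {a m : ℕ} (h : m ≤ a) (j : ℕ) :
    Nat.choose a (m + 1) + j ≤ Nat.choose (a + j) (m + 1) := by
  induction j with
  | zero => simp
  | succ j ih =>
    have h1 : (a + (j + 1)).choose (m + 1) = (a + j).choose m + (a + j).choose (m + 1) :=
      Nat.choose_succ_succ (a + j) m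
    have h2 : 0 < (a + j).choose m := Nat.choose_pos (by omega)
    omega

/-- If (`k = 4` and `n ≥ 8`) or (`k ≥ 5` and `n ≥ k + 3`), then
`C(k, 2) ≤ C(n - 2, k - 2) - n`. -/
theorem choose_ineq (k n : ℕ)
    (h : (k = 4 ∧ 8 ≤ n) ∨ (5 ≤ k ∧ k + 3 ≤ n)) :
    (Nat.choose k 2 : ℤ) ≤ (Nat.choose (n - 2) (k - 2) : ℤ) - (n : ℤ) := by
  suffices Nat.choose k 2 + n ≤ Nat.choose (n - 2) (k - 2) by omega
  rcases h with ⟨rfl, hn⟩ | ⟨hk, hn⟩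
  · obtain ⟨j, rfl⟩ := Nat.exists_eq_add_of_le hn
    have h1 := choose_add_le_choose_add (a := 6) (m := 1) (by norm_num) j
    have h2 : Nat.choose 6 2 = 15 := by decide
    have h3 : Nat.choose 4 2 = 6 := by decide
    rw [show 8 + j - 2 = 6 + j by omega]
    norm_num only at h1 ⊢
    omega
  · obtain ⟨i, rfl⟩ := Nat.exists_eq_add_of_le' hk
    obtain ⟨j, rfl⟩ := Nat.exists_eq_add_of_le hn
    have h1 := choose_add_le_choose_add (a := i + 6) (m := i + 2) (by omega) j
    have h2 : (i + 6).choose (i + 2 + 1) = (i + 6).choose 3 :=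
      Nat.choose_symm_of_eq_add (by omega)
    have h3 := choose_two_add_le_choose_three i
    rw [show i + 5 + 3 + j - 2 = i + 6 + j by omega, show i + 5 - 2 = i + 2 + 1 by omega]
    omega
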